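/- arXiv:1001.0695 — 8 statements merged into one kernel-verified Lean document; each statement's English description precedes it below -/
import Mathlib

section
/- Let d be a positive integer, let C ⊆ ℝ^d be an open convex set, and let 𝓕 be a finite family of real-valued convex functions defined on C, with pointwise minimum g(x) := min_{f ∈ 𝓕} f(x). Suppose g attains a local maximum at a point x* ∈ C, and suppose there are exactly m functions f₁, …, f_m ∈ 𝓕 with m ≤ d such that f_i(x*) = g(x*) for all i = 1, …, m. If none of f₁, …, f_m attains a local minimum at x*, then there exists an affine subspace φ ⊆ ℝ^d of dimension d + 1 − m passing through x* and a neighborhood U ⊆ ℝ^d of x* with U ⊆ C such that g is constant on φ ∩ U. -/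
open Filter Topology

section SupportingFunctional

variable {E : Type*} [NormedAddCommGroup E] [NormedSpace ℝ E] [FiniteDimensional ℝ E]

/-- A convex function on an open set without a local minimum at `a` has a continuous linear
functional supporting its strict sublevel set at `a`. -/
theorem ConvexOn.exists_dual_of_not_isLocalMinOn {C : Set E} (hC : IsOpen C) {f : E → ℝ}
    (hf : ConvexOn ℝ C f) {a : E} (hmin : ¬ IsLocalMinOn f C a) :
    ∃ u : E →L[ℝ] ℝ, (∀ x ∈ C, u (x - a) = 0 → f a ≤ f x) ∧
      ∀ x ∈ C, 0 < u (x - a) → f a < f x := by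
  obtain ⟨b, hbC, hb⟩ : ∃ b ∈ C, f b < f a := by
    by_contra! h
    exact hmin (eventually_nhdsWithin_of_forall h)
  have hopen : IsOpen {x ∈ C | f x < f a} :=
    (hf.continuousOn hC).isOpen_inter_preimage hC isOpen_Iio
  obtain ⟨u, hu⟩ := geometric_hahn_banach_open_point (hf.convex_lt (f a)) hopen
    (x := a) (by simp)
  refine ⟨u, fun x hx h0 => ?_, fun x hx hpos => ?_⟩
  · by_contra! hlt
    have := hu x ⟨hx, hlt⟩
    rw [map_sub] at h0
    linarith
  · by_contra! hle
    rw [map_sub] at hpos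
    have hseg : ∀ᶠ t : ℝ in 𝓝[>] 0, u ((1 - t) • x + t • b) < u a := by
      filter_upwards [Ioo_mem_nhdsGT (zero_lt_one' ℝ)] with t ht
      refine hu _ ⟨hf.1 hx hbC (by linarith [ht.2]) ht.1.le (by ring), ?_⟩
      have := hf.2 hx hbC (by linarith [ht.2] : 0 ≤ 1 - t) ht.1.le (by ring)
      simp only [smul_eq_mul] at this
      nlinarith [ht.1, ht.2, mul_pos ht.1 (sub_pos.2 hb),
        mul_nonneg (sub_nonneg.2 ht.2.le) (sub_nonneg.2 hle)]
    have hlim : Tendsto (fun t : ℝ => u ((1 - t) • x + t • b)) (𝓝[>] 0) (𝓝 (u x)) := by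
      have hcont : Continuous fun t : ℝ => u ((1 - t) • x + t • b) := by fun_prop
      simpa using (hcont.tendsto 0).mono_left nhdsWithin_le_nhds
    have := le_of_tendsto hlim (hseg.mono fun _ h => h.le)
    linarith

end SupportingFunctional

/-- Let `C ⊆ ℝ^d` be an open convex set (`d` a positive integer), let `F`
be a finite family of real-valued convex functions on `C`, and let `g` be their pointwise
minimum. Suppose `g` attains a local maximum at `xs ∈ C`, and suppose there are exactly `m`
functions in `F` (forming the set `M`, with `m ≤ d`) agreeing with `g` at `xs`. If none of
the functions in `M` attains a local minimum at `xs`, then there is an affine subspace `φ`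
of dimension `d + 1 - m` through `xs` and a neighborhood `U ⊆ C` of `xs` such that `g` is
constant on `φ ∩ U`. -/
theorem stmt_0 (d : ℕ) (hd : 0 < d)
    (C : Set (EuclideanSpace ℝ (Fin d))) (hCopen : IsOpen C) (hCconv : Convex ℝ C)
    (F : Finset (EuclideanSpace ℝ (Fin d) → ℝ)) (hF : F.Nonempty)
    (hFconv : ∀ f ∈ F, ConvexOn ℝ C f)
    (g : EuclideanSpace ℝ (Fin d) → ℝ)
    (hg : ∀ x, g x = F.inf' hF (fun f => f x))
    (xs : EuclideanSpace ℝ (Fin d)) (hxs : xs ∈ C)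
    (hmax : IsLocalMaxOn g C xs)
    (m : ℕ) (hmd : m ≤ d)
    (M : Finset (EuclideanSpace ℝ (Fin d) → ℝ)) (hMF : M ⊆ F) (hMcard : M.card = m)
    (hMeq : ∀ f ∈ F, (f xs = g xs ↔ f ∈ M))
    (hnomin : ∀ f ∈ M, ¬ IsLocalMinOn f C xs) :
    ∃ φ : AffineSubspace ℝ (EuclideanSpace ℝ (Fin d)),
      xs ∈ φ ∧ Module.finrank ℝ φ.direction = d + 1 - m ∧
      ∃ U ∈ nhds xs, U ⊆ C ∧ ∀ x ∈ (φ : Set (EuclideanSpace ℝ (Fin d))) ∩ U, g x = g xs := by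
  classical
  have hnhds : C ∈ 𝓝 xs := hCopen.mem_nhds hxs
  have hgle : ∀ f ∈ F, ∀ x, g x ≤ f x := fun f hf x => by
    rw [hg x]; exact Finset.inf'_le (fun f => f x) hf
  have hlocal : ∀ᶠ x in 𝓝 xs, g x ≤ g xs := by
    have h : ∀ᶠ x in 𝓝[C] xs, g x ≤ g xs := hmax
    rwa [nhdsWithin_eq_nhds.2 hnhds] at h
  have hother : ∀ᶠ x in 𝓝 xs, ∀ f ∈ F, f ∉ M → g xs < f x := by
    rw [Filter.eventually_all_finset]
    intro f hf
    by_cases hfM : f ∈ M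
    · simp [hfM]
    · have hlt : g xs < f xs :=
        lt_of_le_of_ne (hgle f hf xs) fun h => hfM ((hMeq f hf).1 h.symm)
      have hcont : ContinuousAt f xs := ((hFconv f hf).continuousOn hCopen).continuousAt hnhds
      exact (hcont.eventually (lt_mem_nhds hlt)).mono fun x hx _ => hx
  have hMval : ∀ f ∈ M, f xs = g xs := fun f hf => (hMeq f (hMF hf)).2 hf
  choose u hu0 hupos using fun f : M =>
    (hFconv f (hMF f.2)).exists_dual_of_not_isLocalMinOn hCopen (hnomin f f.2)
  let T : EuclideanSpace ℝ (Fin d) →ₗ[ℝ] (M → ℝ) := LinearMap.pi fun f => (u f).toLinearMap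
  have hT : ¬ Function.Surjective T := by
    intro hsurj
    obtain ⟨v, hv⟩ := hsurj fun _ => 1
    have huv : ∀ f, u f v = 1 := fun f => congrFun hv f
    have hlim : Tendsto (fun t : ℝ => xs + t • v) (𝓝[>] 0) (𝓝 xs) := by
      have hcont : Continuous fun t : ℝ => xs + t • v := by fun_prop
      simpa using (hcont.tendsto 0).mono_left nhdsWithin_le_nhds
    obtain ⟨t, ⟨⟨hle, hgt⟩, hC⟩, ht⟩ := ((hlim.eventually ((hlocal.and hother).and hnhds)).and
      self_mem_nhdsWithin).exists
    refine hle.not_gt ?_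
    rw [hg (xs + t • v), Finset.lt_inf'_iff]
    intro f hf
    by_cases hfM : f ∈ M
    · rw [← hMval f hfM]
      exact hupos ⟨f, hfM⟩ _ hC (by simpa [huv] using ht)
    · exact hgt f hf hfM
  have hker : d + 1 - m ≤ Module.finrank ℝ (LinearMap.ker T) := by
    have hrange : Module.finrank ℝ (LinearMap.range T) < m := by
      have := Submodule.finrank_lt (s := LinearMap.range T)
        (fun h => hT (LinearMap.range_eq_top.1 h))
      simpa [hMcard] using this
    have hsum := T.finrank_range_add_finrank_ker
    rw [finrank_euclideanSpace_fin] at hsum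
    omega
  obtain ⟨W, hW, hWdim⟩ : ∃ W ≤ LinearMap.ker T, Module.finrank ℝ W = d + 1 - m := by
    obtain ⟨b, hb⟩ := exists_linearIndependent_of_le_finrank hker
    refine ⟨(Submodule.span ℝ (Set.range b)).map (LinearMap.ker T).subtype,
      Submodule.map_subtype_le _ _, ?_⟩
    rw [Submodule.finrank_map_subtype_eq, finrank_span_eq_card hb, Fintype.card_fin]
  refine ⟨AffineSubspace.mk' xs W, AffineSubspace.self_mem_mk' xs W, by
    rwa [AffineSubspace.direction_mk'],
    _, (hlocal.and hother).and hnhds, fun x hx => hx.2, ?_⟩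
  rintro x ⟨hxW, ⟨hle, hgt⟩, hxC⟩
  refine le_antisymm hle ?_
  rw [hg x, Finset.le_inf'_iff]
  intro f hf
  by_cases hfM : f ∈ M
  · rw [← hMval f hfM]
    have hx : T (x - xs) = 0 := hW hxW
    exact hu0 ⟨f, hfM⟩ x hxC (congrFun hx ⟨f, hfM⟩)
  · exact (hgt f hf hfM).le
end

section
/- Let d and m be positive integers with m ≤ d. Any collection of m closed hemispheres on the unit sphere S^{d−1} ⊆ ℝ^d has a nonempty common intersection. -/
open scoped RealInnerProductSpace

/-- At most `finrank ℝ E` closed half-spaces through the origin share a nonzero vector. -/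
theorem exists_ne_zero_forall_inner_nonneg {E ι : Type*} [NormedAddCommGroup E]
    [InnerProductSpace ℝ E] [FiniteDimensional ℝ E] [Fintype ι] [Nonempty ι]
    (h : Fintype.card ι ≤ Module.finrank ℝ E) (a : ι → E) :
    ∃ y : E, y ≠ 0 ∧ ∀ i, 0 ≤ ⟪a i, y⟫ := by
  let L : E →ₗ[ℝ] ι → ℝ := LinearMap.pi fun i => innerₗ E (a i)
  have hL : ∀ y i, L y i = ⟪a i, y⟫ := fun _ _ => rfl
  by_cases hinj : Function.Injective L
  · have hrank : Module.finrank ℝ E = Module.finrank ℝ (ι → ℝ) :=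
      le_antisymm (LinearMap.finrank_le_finrank_of_injective hinj) (by simpa using h)
    obtain ⟨y, hy⟩ := (LinearMap.injective_iff_surjective_of_finrank_eq_finrank hrank).1 hinj 1
    refine ⟨y, ?_, fun i => ?_⟩
    · rintro rfl
      rw [map_zero] at hy
      exact zero_ne_one hy
    · simp [← hL, hy]
  · rw [← LinearMap.ker_eq_bot, Submodule.eq_bot_iff] at hinj
    push Not at hinj
    obtain ⟨y, hy, hy0⟩ := hinj
    refine ⟨y, hy0, fun i => ?_⟩
    simp [← hL, LinearMap.mem_ker.1 hy]

/-- Let `d` and `m` be positive integers with `m ≤ d`. Any collection of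
`m` closed hemispheres on the unit sphere `S^{d-1} ⊆ ℝ^d` (each given as
`{x : ‖x‖ = 1} ∩ {x : ⟪a i, x⟫ ≥ 0}` for a nonzero vector `a i`) has a nonempty common
intersection. -/
theorem stmt_1 (d m : ℕ) (hd : 0 < d) (hm : 0 < m) (hmd : m ≤ d)
    (a : Fin m → EuclideanSpace ℝ (Fin d)) (ha : ∀ i, a i ≠ 0) :
    ∃ x : EuclideanSpace ℝ (Fin d), ‖x‖ = 1 ∧ ∀ i, 0 ≤ ⟪a i, x⟫ := by
  have : Nonempty (Fin m) := ⟨⟨0, hm⟩⟩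
  obtain ⟨y, hy0, hy⟩ := exists_ne_zero_forall_inner_nonneg (by simpa using hmd) a
  refine ⟨‖y‖⁻¹ • y, norm_smul_inv_norm hy0, fun i => ?_⟩
  rw [real_inner_smul_right]
  exact mul_nonneg (by positivity) (hy i)
end

section
/- Let d and m be positive integers with m ≤ d, and let H₁, …, H_m be closed hemispheres on the unit sphere S^{d−1} ⊆ ℝ^d. If the common intersection H₁ ∩ ⋯ ∩ H_m has empty interior relative to S^{d−1}, then H₁ ∩ ⋯ ∩ H_m includes a great (d−m)-sphere on S^{d−1}, i.e., there exists a linear subspace W ⊆ ℝ^d of dimension d − m + 1 such that S^{d−1} ∩ W ⊆ H₁ ∩ ⋯ ∩ H_m. -/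
open scoped RealInnerProductSpace

/-- Every dimension up to that of a subspace `K` is attained by a subspace of `K`. -/
theorem Submodule.exists_le_finrank_eq {k V : Type*} [DivisionRing k] [AddCommGroup V] [Module k V]
    (K : Submodule k V) {n : ℕ} (hn : n ≤ Module.finrank k K) :
    ∃ W ≤ K, Module.finrank k W = n := by
  obtain ⟨v, hv⟩ := exists_linearIndependent_of_le_finrank hn
  refine ⟨(span k (Set.range v)).map K.subtype, map_subtype_le _ _, ?_⟩
  rw [finrank_map_subtype_eq, finrank_span_eq_card hv, Fintype.card_fin]

/-- Either some `x` has positive inner product with every `a i`, or the vectors `a i` are all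
orthogonal to a subspace of dimension one more than the generic `dim E - card ι`. -/
theorem exists_forall_inner_pos_or_exists_submodule {E ι : Type*} [NormedAddCommGroup E]
    [InnerProductSpace ℝ E] [FiniteDimensional ℝ E] [Fintype ι] (a : ι → E)
    (hcard : Fintype.card ι ≤ Module.finrank ℝ E) :
    (∃ x, ∀ i, 0 < ⟪a i, x⟫) ∨
      ∃ W : Submodule ℝ E, Module.finrank ℝ W = Module.finrank ℝ E - Fintype.card ι + 1 ∧
        ∀ x ∈ W, ∀ i, ⟪a i, x⟫ = 0 := by
  let T : E →ₗ[ℝ] ι → ℝ := LinearMap.pi fun i => innerₛₗ ℝ (a i)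
  by_cases h : Module.finrank ℝ E - Fintype.card ι + 1 ≤ Module.finrank ℝ T.ker
  · obtain ⟨W, hW, hdim⟩ := Submodule.exists_le_finrank_eq _ h
    exact Or.inr ⟨W, hdim, fun x hx i => congrFun (LinearMap.mem_ker.mp (hW hx)) i⟩
  · left
    have hrn := T.finrank_range_add_finrank_ker
    have hle := T.range.finrank_le
    rw [Module.finrank_fintype_fun_eq_card] at hle
    have hT : T.range = ⊤ := Submodule.eq_top_of_finrank_eq (by
      rw [Module.finrank_fintype_fun_eq_card]; omega)
    obtain ⟨x, hx⟩ := LinearMap.range_eq_top.mp hT fun _ => 1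
    exact ⟨x, fun i => one_pos.trans_eq (congrFun hx i).symm⟩

/-- Let `m ≤ d` be positive integers and let `H i` be closed hemispheres
on the unit sphere `S^{d-1} ⊆ ℝ^d`, given by nonzero vectors `a i`. If the common
intersection `⋂ i, H i` has empty interior relative to `S^{d-1}` (i.e. every open set `U`
of `ℝ^d` with `U ∩ S ⊆ ⋂ i, H i` satisfies `U ∩ S = ∅`), then `⋂ i, H i` contains a great
`(d-m)`-sphere: there is a linear subspace `W` of dimension `d - m + 1` with
`S ∩ W ⊆ ⋂ i, H i`. -/
theorem stmt_2 (d m : ℕ) (hd : 0 < d) (hm : 0 < m) (hmd : m ≤ d)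
    (a : Fin m → EuclideanSpace ℝ (Fin d)) (ha : ∀ i, a i ≠ 0)
    (S : Set (EuclideanSpace ℝ (Fin d))) (hS : S = {x | ‖x‖ = 1})
    (H : Fin m → Set (EuclideanSpace ℝ (Fin d)))
    (hH : ∀ i, H i = S ∩ {x | 0 ≤ ⟪a i, x⟫})
    (hempty : ∀ U : Set (EuclideanSpace ℝ (Fin d)),
      IsOpen U → U ∩ S ⊆ ⋂ i, H i → U ∩ S = ∅) :
    ∃ W : Submodule ℝ (EuclideanSpace ℝ (Fin d)),
      Module.finrank ℝ W = d - m + 1 ∧ S ∩ (W : Set (EuclideanSpace ℝ (Fin d))) ⊆ ⋂ i, H i := by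
  subst hS
  obtain rfl : H = fun i => {x | ‖x‖ = 1} ∩ {x | 0 ≤ ⟪a i, x⟫} := funext hH
  rcases exists_forall_inner_pos_or_exists_submodule a (by simpa using hmd) with
    ⟨x, hx⟩ | ⟨W, hdim, hW⟩
  · exfalso
    have hx0 : x ≠ 0 := by
      rintro rfl
      simpa using hx ⟨0, hm⟩
    have hopen : IsOpen {y | ∀ i, 0 < ⟪a i, y⟫} := by
      simp only [Set.ofPred_forall]
      exact isOpen_iInter_of_finite fun i => isOpen_lt (by fun_prop) (by fun_prop)
    have hinter := hempty _ hopen fun y hy => Set.mem_iInter.mpr fun i => ⟨hy.2, (hy.1 i).le⟩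
    refine Set.eq_empty_iff_forall_notMem.mp hinter (‖x‖⁻¹ • x) ⟨fun i => ?_, ?_⟩
    · rw [real_inner_smul_right]
      exact mul_pos (inv_pos.mpr (norm_pos_iff.mpr hx0)) (hx i)
    · exact norm_smul_inv_norm (𝕜 := ℝ) hx0
  · exact ⟨W, by simpa using hdim, fun x hx => Set.mem_iInter.mpr fun i =>
      ⟨hx.1, (hW x hx.2 i).ge⟩⟩
end

section
/- Let C ⊆ ℝ^d be an open convex set, let f : C → ℝ be convex, and let x* ∈ C be a point at which f does not attain a local minimum. Then there exists a nonzero vector a ∈ ℝ^d such that for every x ∈ C: if ⟨a, x − x*⟩ ≥ 0 then f(x) ≥ f(x*), and if ⟨a, x − x*⟩ > 0 then f(x) > f(x*). -/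
open scoped RealInnerProductSpace

/-- Let `C ⊆ ℝ^d` be an open convex set, `f` convex on `C`, and `xs ∈ C`
a point at which `f` does not attain a local minimum. Then there is a nonzero vector `a`
such that for every `x ∈ C`: `⟪a, x - xs⟫ ≥ 0` implies `f x ≥ f xs`, and
`⟪a, x - xs⟫ > 0` implies `f x > f xs`. -/
theorem stmt_3 (d : ℕ) (C : Set (EuclideanSpace ℝ (Fin d)))
    (hCopen : IsOpen C) (hCconv : Convex ℝ C)
    (f : EuclideanSpace ℝ (Fin d) → ℝ) (hf : ConvexOn ℝ C f)
    (xs : EuclideanSpace ℝ (Fin d)) (hxs : xs ∈ C)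
    (hnomin : ¬ IsLocalMinOn f C xs) :
    ∃ a : EuclideanSpace ℝ (Fin d), a ≠ 0 ∧ ∀ x ∈ C,
      (0 ≤ ⟪a, x - xs⟫ → f xs ≤ f x) ∧ (0 < ⟪a, x - xs⟫ → f xs < f x) := by
  have hcont : ContinuousOn f C := hf.continuousOn hCopen
  have hSopen : IsOpen {x ∈ C | f x < f xs} := hcont.isOpen_inter_preimage hCopen isOpen_Iio
  have hSne : ∃ z ∈ C, f z < f xs := by
    by_contra! h
    exact hnomin (IsMinOn.localize (fun x hx => h x hx))
  obtain ⟨z, hzC, hz⟩ := hSne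
  obtain ⟨φ, hφ⟩ := geometric_hahn_banach_open_point (hf.convex_lt (f xs)) hSopen
    (x := xs) (fun h => lt_irrefl _ h.2)
  have hφz : φ z < φ xs := hφ z ⟨hzC, hz⟩
  refine ⟨(InnerProductSpace.toDual ℝ _).symm φ, ?_, fun x hx => ?_⟩
  · rintro h
    rw [LinearIsometryEquiv.map_eq_zero_iff] at h
    simp [h] at hφz
  rw [InnerProductSpace.toDual_symm_apply, map_sub, sub_nonneg, sub_pos]
  refine ⟨fun h => ?_, fun h => ?_⟩
  · by_contra! hlt
    exact (hφ x ⟨hx, hlt⟩).not_ge h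
  · by_contra! hle
    have hp : 0 < φ xs - φ z := sub_pos.2 hφz
    have hq : 0 < φ x - φ xs := sub_pos.2 h
    have hpq : 0 < φ x - φ z := by linarith
    set s := (φ x - φ xs) / (φ x - φ z) with hs
    set t := (φ xs - φ z) / (φ x - φ z) with ht
    have hs0 : 0 < s := div_pos hq hpq
    have ht0 : 0 < t := div_pos hp hpq
    have hst : s + t = 1 := by rw [hs, ht]; field_simp; ring
    have hlt : f (s • z + t • x) < f xs := calc
      f (s • z + t • x) ≤ s * f z + t * f x := hf.2 hzC hx hs0.le ht0.le hst
      _ < s * f xs + t * f xs :=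
        add_lt_add_of_lt_of_le (mul_lt_mul_of_pos_left hz hs0)
          (mul_le_mul_of_nonneg_left hle ht0.le)
      _ = f xs := by rw [← add_mul, hst, one_mul]
    have hφw : φ (s • z + t • x) = φ xs := by
      simp only [map_add, map_smul, smul_eq_mul, hs, ht]
      field_simp
      ring
    exact (hφ _ ⟨hCconv hzC hx hs0.le ht0.le hst, hlt⟩).ne hφw
end

section
/- Let u, u' ∈ ℝ² be distinct points, let ℓ₀ be the line through u and u', and let H⁺ and H⁻ be the two closed halfplanes of ℝ² bounded by ℓ₀. Let C ⊆ ℝ² be a convex set such that for every s ∈ C ∩ ℓ₀, the point u lies on the segment from s to u' and s ≠ u. Define h : C → ℝ by h(s) = ‖s − u'‖ if s ∈ C ∩ H⁺, and h(s) = ‖s − u‖ + ‖u − u'‖ if s ∈ C ∩ (H⁻ \ H⁺). Then h is well defined and convex on C. -/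
open scoped RealInnerProductSpace

section

variable {E : Type*} [NormedAddCommGroup E]

theorem norm_convexCombo_sub_le [NormedSpace ℝ E] (x y v : E) {a b : ℝ}
    (ha : 0 ≤ a) (hb : 0 ≤ b) (hab : a + b = 1) :
    ‖a • x + b • y - v‖ ≤ a * ‖x - v‖ + b * ‖y - v‖ := by
  simpa only [dist_eq_norm, smul_eq_mul] using
    (convexOn_dist v convex_univ).2 (Set.mem_univ x) (Set.mem_univ y) ha hb hab

theorem norm_sub_eq_add_of_mem_segment [NormedSpace ℝ E] {u v s : E} (hu : u ∈ segment ℝ s v) :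
    ‖s - v‖ = ‖s - u‖ + ‖u - v‖ := by
  simpa only [dist_eq_norm] using (dist_add_dist_of_mem_segment hu).symm

/-- If `u` lies strictly past `z = c • x + d • y` on the way to `v`, then the distances from `s`
to `v`, directly or through `u`, have the same gradient at `s = z`, and hence a common affine
minorant touching both at `z`. -/
theorem norm_sub_le_convexCombo_of_mem_segment [InnerProductSpace ℝ E] {u v x y z : E} {c d : ℝ}
    (hc : 0 ≤ c) (hd : 0 ≤ d) (hcd : c + d = 1) (hz : z = c • x + d • y)
    (hu : u ∈ segment ℝ z v) (hne : z ≠ u) :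
    ‖z - v‖ ≤ c * ‖x - v‖ + d * (‖y - u‖ + ‖u - v‖) := by
  have hw : 0 < ‖z - u‖ := norm_pos_iff.2 (sub_ne_zero.2 hne)
  have hray : ⟪z - u, z - v⟫ = ‖z - u‖ * ‖z - v‖ := by
    obtain ⟨a, b, -, hb, hab, rfl⟩ := hu
    have hsub : z - (a • z + b • v) = b • (z - v) := by
      obtain rfl : a = 1 - b := by linarith
      module
    rw [hsub, real_inner_smul_left, real_inner_self_eq_norm_sq, norm_smul, Real.norm_of_nonneg hb]
    ring
  have hsplit : ⟪z - u, z - v⟫ =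
      c * ⟪z - u, x - v⟫ + d * (⟪z - u, y - u⟫ + ⟪z - u, u - v⟫) := by
    have hsum : z - v = c • (x - v) + d • ((y - u) + (u - v)) := by
      obtain rfl : c = 1 - d := by linarith
      rw [hz]
      module
    rw [hsum, inner_add_right, real_inner_smul_right, real_inner_smul_right, inner_add_right]
  have hx := mul_le_mul_of_nonneg_left (real_inner_le_norm (z - u) (x - v)) hc
  have hy := mul_le_mul_of_nonneg_left
    (add_le_add (real_inner_le_norm (z - u) (y - u)) (real_inner_le_norm (z - u) (u - v))) hd
  refine le_of_mul_le_mul_left ?_ hw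
  linarith

/-- The path through `u` from a point of the open negative side of the hyperplane is at most the
convex combination of the direct path from `x` and the path through `u` from `y`. -/
theorem norm_convexCombo_sub_add_le [InnerProductSpace ℝ E] {u v n x y : E} {C : Set E}
    (hC : Convex ℝ C) (hseg : ∀ s ∈ C, ⟪n, s - u⟫ = 0 → u ∈ segment ℝ s v ∧ s ≠ u)
    (hxC : x ∈ C) (hyC : y ∈ C) (hx : 0 ≤ ⟪n, x - u⟫) (hy : ⟪n, y - u⟫ < 0) {a b : ℝ}
    (ha : 0 ≤ a) (hab : a + b = 1) (hp : ⟪n, a • x + b • y - u⟫ < 0) :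
    ‖a • x + b • y - u‖ + ‖u - v‖ ≤ a * ‖x - v‖ + b * (‖y - u‖ + ‖u - v‖) := by
  have hinner : ∀ a b : ℝ, a + b = 1 →
      ⟪n, a • x + b • y - u⟫ = a * ⟪n, x - u⟫ + b * ⟪n, y - u⟫ := by
    intro a b hab
    have hsum : a • x + b • y - u = a • (x - u) + b • (y - u) := by
      obtain rfl : a = 1 - b := by linarith
      module
    rw [hsum, inner_add_right, real_inner_smul_right, real_inner_smul_right]
  rw [hinner a b hab] at hp
  set X := ⟪n, x - u⟫
  set Y := ⟪n, y - u⟫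
  have hXY : 0 < X - Y := by linarith
  obtain ⟨c, hcdef⟩ : ∃ c, c = -Y / (X - Y) := ⟨_, rfl⟩
  have hcmul : c * (X - Y) = -Y := by rw [hcdef]; field_simp
  have hc : 0 < c := by rw [hcdef]; exact div_pos (by linarith) hXY
  have hc1 : 0 ≤ 1 - c := by
    rw [sub_nonneg, hcdef, div_le_one hXY]
    linarith
  have hac : a ≤ c := by
    obtain rfl : b = 1 - a := by linarith
    refine le_of_mul_le_mul_right ?_ hXY
    linarith
  have hzC : c • x + (1 - c) • y ∈ C := hC hxC hyC hc.le hc1 (by ring)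
  obtain ⟨hu, hne⟩ := hseg _ hzC (by rw [hinner c (1 - c) (by ring)]; linarith)
  have hz := norm_sub_le_convexCombo_of_mem_segment hc.le hc1 (by ring) rfl hu hne
  rw [norm_sub_eq_add_of_mem_segment hu] at hz
  obtain ⟨t, rfl⟩ : ∃ t, a = t * c := ⟨a / c, by field_simp⟩
  have ht : 0 ≤ t := nonneg_of_mul_nonneg_left ha hc
  have ht1 : 0 ≤ 1 - t := by
    rw [sub_nonneg]
    refine le_of_mul_le_mul_right ?_ hc
    linarith
  obtain rfl : b = 1 - t * c := by linarith
  have hcombo := norm_convexCombo_sub_le (c • x + (1 - c) • y) y u ht ht1 (by ring)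
  have hpoint : t • (c • x + (1 - c) • y) + (1 - t) • y = (t * c) • x + (1 - t * c) • y := by
    module
  rw [hpoint] at hcombo
  linarith [mul_le_mul_of_nonneg_left hz ht]

end

/-- Let `u ≠ u'` be points of `ℝ²` and let `ℓ₀` be the line through `u`
and `u'`, described as `{s | ⟪nvec, s - u⟫ = 0}` where `nvec ≠ 0` is a normal vector with
`⟪nvec, u' - u⟫ = 0`.  The two closed halfplanes bounded by `ℓ₀` are
`H⁺ = {s | 0 ≤ ⟪nvec, s - u⟫}` and `H⁻ = {s | ⟪nvec, s - u⟫ ≤ 0}`.  Let `C ⊆ ℝ²` be a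
convex set such that every `s ∈ C ∩ ℓ₀` satisfies `u ∈ segment s u'` and `s ≠ u`.  Define
`h s = ‖s - u'‖` on `C ∩ H⁺` and `h s = ‖s - u‖ + ‖u - u'‖` on `C ∩ (H⁻ \ H⁺)`
(the latter set being `{s ∈ C | ⟪nvec, s - u⟫ < 0}`).  Then `h` is well defined
(the two formulas agree on `C ∩ ℓ₀`) and convex on `C`. -/
theorem stmt_6 (u u' : EuclideanSpace ℝ (Fin 2)) (huu' : u ≠ u')
    (nvec : EuclideanSpace ℝ (Fin 2)) (hn : nvec ≠ 0) (hperp : ⟪nvec, u' - u⟫ = 0)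
    (C : Set (EuclideanSpace ℝ (Fin 2))) (hC : Convex ℝ C)
    (hseg : ∀ s ∈ C, ⟪nvec, s - u⟫ = 0 → u ∈ segment ℝ s u' ∧ s ≠ u)
    (h : EuclideanSpace ℝ (Fin 2) → ℝ)
    (hdef : ∀ s ∈ C,
      (0 ≤ ⟪nvec, s - u⟫ → h s = ‖s - u'‖) ∧
      (⟪nvec, s - u⟫ < 0 → h s = ‖s - u‖ + ‖u - u'‖)) :
    (∀ s ∈ C, ⟪nvec, s - u⟫ = 0 → ‖s - u'‖ = ‖s - u‖ + ‖u - u'‖) ∧ ConvexOn ℝ C h := by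
  refine ⟨fun s hs h0 => norm_sub_eq_add_of_mem_segment (hseg s hs h0).1, hC, ?_⟩
  have hle : ∀ s ∈ C, ‖s - u'‖ ≤ h s := by
    intro s hs
    rcases le_or_gt 0 ⟪nvec, s - u⟫ with hpos | hneg
    · exact ((hdef s hs).1 hpos).ge
    · rw [(hdef s hs).2 hneg]
      exact norm_sub_le_norm_sub_add_norm_sub s u u'
  intro x hx y hy a b ha hb hab
  have hp := hC hx hy ha hb hab
  simp only [smul_eq_mul]
  rcases le_or_gt 0 ⟪nvec, a • x + b • y - u⟫ with hpos | hneg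
  · rw [(hdef _ hp).1 hpos]
    refine (norm_convexCombo_sub_le x y u' ha hb hab).trans ?_
    gcongr
    exacts [hle x hx, hle y hy]
  rw [(hdef _ hp).2 hneg]
  rcases le_or_gt 0 ⟪nvec, x - u⟫ with hxpos | hxneg <;>
    rcases le_or_gt 0 ⟪nvec, y - u⟫ with hypos | hyneg
  · have hsum : a • x + b • y - u = a • (x - u) + b • (y - u) := by
      obtain rfl : a = 1 - b := by linarith
      module
    rw [hsum, inner_add_right, real_inner_smul_right, real_inner_smul_right] at hneg
    exact absurd hneg (not_lt.2 (by positivity))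
  · rw [(hdef x hx).1 hxpos, (hdef y hy).2 hyneg]
    exact norm_convexCombo_sub_add_le hC hseg hx hy hxpos hyneg ha hab hneg
  · rw [(hdef x hx).2 hxneg, (hdef y hy).1 hypos]
    rw [add_comm (a • x)] at hneg ⊢
    rw [add_comm (a * _)]
    exact norm_convexCombo_sub_add_le hC hseg hy hx hypos hxneg hb (by linarith) hneg
  · rw [(hdef x hx).2 hxneg, (hdef y hy).2 hyneg]
    obtain rfl : a = 1 - b := by linarith
    linarith [norm_convexCombo_sub_le x y u ha hb hab]
end

section
/- Let u, v ∈ ℝ², let c ∈ ℝ, and let s*, t* ∈ ℝ² with s* ≠ u and t* ≠ v. Define f(s, t) := ‖s − u‖ + c + ‖t − v‖ on ℝ² × ℝ² ≅ ℝ⁴, and set d_s := (u − s*)/‖u − s*‖ and d_t := (t* − v)/‖t* − v‖. If ℓ ⊆ ℝ⁴ is a line through the point (s*, t*) such that f is constant on ℓ ∩ U for some neighborhood U ⊆ ℝ⁴ of (s*, t*), then ℓ = {(s* + λ d_s, t* + λ d_t) : λ ∈ ℝ}. That is, there is a unique line through (s*, t*) along which f is locally constant. -/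
theorem two_mul_norm_le_norm_add_add_norm_sub {E : Type*} [NormedAddCommGroup E]
    [NormedSpace ℝ E] (x y : E) : 2 * ‖x‖ ≤ ‖x + y‖ + ‖x - y‖ := by
  have h := norm_add_le (x + y) (x - y)
  rwa [show (x + y) + (x - y) = (2 : ℝ) • x by module, norm_smul, Real.norm_two] at h

/-- A nontrivial subspace contains nonzero vectors `d` such that both `x + d` and `x - d` lie in a
given neighbourhood of `x`. -/
theorem Submodule.exists_ne_zero_add_mem_sub_mem {E : Type*} [NormedAddCommGroup E]
    [NormedSpace ℝ E] {V : Submodule ℝ E} (hV : V ≠ ⊥) {x : E} {U : Set E} (hU : U ∈ nhds x) :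
    ∃ d ∈ V, d ≠ 0 ∧ x + d ∈ U ∧ x - d ∈ U := by
  obtain ⟨e, he, he₀⟩ := V.ne_bot_iff.1 hV
  have hadd : Filter.Tendsto (fun t : ℝ => x + t • e) (nhds 0) (nhds x) :=
    Continuous.tendsto' (by fun_prop) _ _ (by simp)
  have hsub : Filter.Tendsto (fun t : ℝ => x - t • e) (nhds 0) (nhds x) :=
    Continuous.tendsto' (by fun_prop) _ _ (by simp)
  obtain ⟨t, ⟨h₁, h₂⟩, ht⟩ := Filter.nonempty_of_mem <| Filter.inter_mem
    (mem_nhdsWithin_of_mem_nhds (Filter.inter_mem (hadd hU) (hsub hU)))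
    (self_mem_nhdsWithin (a := (0 : ℝ)) (s := {0}ᶜ))
  exact ⟨t • e, V.smul_mem t he, smul_ne_zero ht he₀, h₁, h₂⟩

/-- If the norm of a strictly convex space does not exceed its value at `w` on average over
`w + a` and `w - a`, then `a` is a multiple of `w`, small enough that the norm is linear. -/
theorem exists_eq_smul_of_norm_add_norm_sub_le {E : Type*} [NormedAddCommGroup E]
    [NormedSpace ℝ E] [StrictConvexSpace ℝ E] {w a : E}
    (h : ‖w + a‖ + ‖w - a‖ ≤ 2 * ‖w‖) :
    ∃ r : ℝ, a = r • w ∧ ‖w + a‖ = (1 + r) * ‖w‖ := by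
  have hsum : (w + a) + (w - a) = (2 : ℝ) • w := by module
  have hray : SameRay ℝ (w + a) (w - a) := by
    rw [sameRay_iff_norm_add]
    refine le_antisymm (norm_add_le _ _) ?_
    rwa [hsum, norm_smul, Real.norm_two]
  obtain ⟨p, -, hp, -, -, h₁, -⟩ := hray.exists_eq_smul_add
  rw [hsum, smul_smul] at h₁
  refine ⟨p * 2 - 1, ?_, ?_⟩
  · rw [sub_smul, one_smul, ← h₁, add_sub_cancel_left]
  · rw [h₁, norm_smul, Real.norm_of_nonneg (by positivity)]
    ring

/-- A nonzero vector along which `‖·‖ + ‖·‖` takes the same value at `(w, z)` and at both of its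
translates is a nonzero multiple of the pair of opposite unit vectors. -/
theorem exists_eq_smul_of_norm_add_norm_const {E F : Type*}
    [NormedAddCommGroup E] [NormedSpace ℝ E] [StrictConvexSpace ℝ E]
    [NormedAddCommGroup F] [NormedSpace ℝ F] [StrictConvexSpace ℝ F]
    {w : E} {z : F} (hw : w ≠ 0) (hz : z ≠ 0) {d : E × F} (hd : d ≠ 0)
    (hadd : ‖w + d.1‖ + ‖z + d.2‖ = ‖w‖ + ‖z‖) (hsub : ‖w - d.1‖ + ‖z - d.2‖ = ‖w‖ + ‖z‖) :
    ∃ k : ℝ, k ≠ 0 ∧ d = k • (-(‖w‖⁻¹ • w), ‖z‖⁻¹ • z) := by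
  have hw₂ := two_mul_norm_le_norm_add_add_norm_sub w d.1
  have hz₂ := two_mul_norm_le_norm_add_add_norm_sub z d.2
  obtain ⟨r, hr, hr'⟩ := exists_eq_smul_of_norm_add_norm_sub_le (w := w) (a := d.1) (by linarith)
  obtain ⟨q, hq, hq'⟩ := exists_eq_smul_of_norm_add_norm_sub_le (w := z) (a := d.2) (by linarith)
  have hrq : -(r * ‖w‖) = q * ‖z‖ := by linarith
  have hdk : d = (-(r * ‖w‖)) • (-(‖w‖⁻¹ • w), ‖z‖⁻¹ • z) := by
    refine Prod.ext ?_ ?_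
    · rw [hr, Prod.smul_fst, smul_neg, neg_smul, neg_neg, smul_smul,
        mul_inv_cancel_right₀ (norm_ne_zero_iff.2 hw)]
    · rw [hq, hrq, Prod.smul_snd, smul_smul, mul_inv_cancel_right₀ (norm_ne_zero_iff.2 hz)]
  refine ⟨_, fun hk => hd ?_, hdk⟩
  rw [hdk, hk, zero_smul]

/-- Let `u, v ∈ ℝ²`, `c ∈ ℝ`, and `sstar ≠ u`, `tstar ≠ v`.  Define
`f (s, t) = ‖s - u‖ + c + ‖t - v‖` on `ℝ² × ℝ² ≅ ℝ⁴`, and set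
`ds = (u - sstar)/‖u - sstar‖`, `dt = (tstar - v)/‖tstar - v‖`.  If `ℓ` is a line
(a 1-dimensional affine subspace of `ℝ⁴`) through `(sstar, tstar)` such that `f` is
constant on `ℓ ∩ U` for some neighborhood `U` of `(sstar, tstar)`, then
`ℓ = {(sstar + lam • ds, tstar + lam • dt) : lam ∈ ℝ}`; i.e. there is a unique line
through `(sstar, tstar)` along which `f` is locally constant. -/
theorem stmt_8 (u v sstar tstar : EuclideanSpace ℝ (Fin 2))
    (hs : sstar ≠ u) (ht : tstar ≠ v) (c : ℝ)
    (f : EuclideanSpace ℝ (Fin 2) × EuclideanSpace ℝ (Fin 2) → ℝ)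
    (hf : ∀ p, f p = ‖p.1 - u‖ + c + ‖p.2 - v‖)
    (ds dt : EuclideanSpace ℝ (Fin 2))
    (hds : ds = ‖u - sstar‖⁻¹ • (u - sstar)) (hdt : dt = ‖tstar - v‖⁻¹ • (tstar - v))
    (ℓ : AffineSubspace ℝ (EuclideanSpace ℝ (Fin 2) × EuclideanSpace ℝ (Fin 2)))
    (hmem : (sstar, tstar) ∈ ℓ) (hdim : Module.finrank ℝ ℓ.direction = 1)
    (U : Set (EuclideanSpace ℝ (Fin 2) × EuclideanSpace ℝ (Fin 2)))
    (hU : U ∈ nhds (sstar, tstar))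
    (hconst : ∀ p ∈ (ℓ : Set (EuclideanSpace ℝ (Fin 2) × EuclideanSpace ℝ (Fin 2))) ∩ U,
      f p = f (sstar, tstar)) :
    (ℓ : Set (EuclideanSpace ℝ (Fin 2) × EuclideanSpace ℝ (Fin 2))) =
      {q | ∃ lam : ℝ, q = (sstar + lam • ds, tstar + lam • dt)} := by
  have hbot : ℓ.direction ≠ ⊥ := by
    intro h
    rw [h, finrank_bot] at hdim
    exact zero_ne_one hdim
  obtain ⟨d, hd, hd₀, hdU, hdU'⟩ := Submodule.exists_ne_zero_add_mem_sub_mem hbot hU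
  have hadd := hconst _ ⟨by
    simpa [add_comm] using AffineSubspace.vadd_mem_of_mem_direction hd hmem, hdU⟩
  have hsub := hconst _ ⟨by
    simpa [sub_eq_add_neg, add_comm] using
      AffineSubspace.vadd_mem_of_mem_direction (neg_mem hd) hmem, hdU'⟩
  simp only [hf, Prod.fst_add, Prod.snd_add, Prod.fst_sub, Prod.snd_sub] at hadd hsub
  rw [add_sub_right_comm, add_sub_right_comm] at hadd
  rw [sub_right_comm, sub_right_comm tstar] at hsub
  obtain ⟨k, hk, hdk⟩ := exists_eq_smul_of_norm_add_norm_const (sub_ne_zero.2 hs)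
    (sub_ne_zero.2 ht) hd₀ (by linarith) (by linarith)
  have hdir : (-(‖sstar - u‖⁻¹ • (sstar - u)), ‖tstar - v‖⁻¹ • (tstar - v)) = (ds, dt) := by
    rw [hds, hdt, norm_sub_rev u, ← smul_neg, neg_sub]
  rw [hdir] at hdk
  have hmem_dir : (ds, dt) ∈ ℓ.direction := by
    rwa [hdk, Submodule.smul_mem_iff _ hk] at hd
  have hne : (⟨(ds, dt), hmem_dir⟩ : ℓ.direction) ≠ 0 := by
    intro h
    rw [Submodule.mk_eq_zero] at h
    rw [hdk, h, smul_zero] at hd₀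
    exact hd₀ rfl
  ext q
  rw [SetLike.mem_coe, ← AffineSubspace.vsub_right_mem_direction_iff_mem hmem]
  constructor
  · intro hq
    obtain ⟨lam, hlam⟩ := (finrank_eq_one_iff_of_nonzero' _ hne).1 hdim ⟨_, hq⟩
    refine ⟨lam, ?_⟩
    have h : lam • (ds, dt) = q - (sstar, tstar) := congrArg Subtype.val hlam
    rw [← sub_add_cancel q (sstar, tstar), ← h, add_comm]
    rfl
  · rintro ⟨lam, rfl⟩
    convert ℓ.direction.smul_mem lam hmem_dir using 1
    exact add_sub_cancel_left (sstar, tstar) (lam • (ds, dt))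
end

section
/- Let f₁, f₂, f₃, f₄, f₅ : ℝ⁴ → ℝ be convex and differentiable, and let x* ∈ ℝ⁴ be a point with f₁(x*) = f₂(x*) = f₃(x*) = f₄(x*) = f₅(x*). Suppose the four gradient vectors ∇f₂(x*), ∇f₃(x*), ∇f₄(x*), ∇f₅(x*) are linearly independent in ℝ⁴ and that ∇f₁(x*) = a₂∇f₂(x*) + a₃∇f₃(x*) + a₄∇f₄(x*) + a₅∇f₅(x*) for some real coefficients a₂, a₃, a₄, a₅ that are all negative. Then x* is a local maximum of the pointwise minimum g(x) := min{f₁(x), f₂(x), f₃(x), f₄(x), f₅(x)}. -/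
/-- If at `x₀` every nonzero direction is a strict descent direction for one of finitely many
differentiable functions, then near `x₀` one of them never exceeds its value at `x₀`. -/
theorem eventually_exists_le_of_forall_exists_fderiv_neg {ι E : Type*} [Fintype ι] [Nonempty ι]
    [NormedAddCommGroup E] [NormedSpace ℝ E] [FiniteDimensional ℝ E]
    {F : ι → E → ℝ} {F' : ι → E →L[ℝ] ℝ} {x₀ : E} (hF : ∀ i, HasFDerivAt (F i) (F' i) x₀)
    (hneg : ∀ v : E, v ≠ 0 → ∃ i, F' i v < 0) :
    ∀ᶠ x in nhds x₀, ∃ i, F i x ≤ F i x₀ := by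
  have hcont : Continuous fun v : E ↦
      Finset.univ.sup' Finset.univ_nonempty fun i ↦ -(F' i v) :=
    Continuous.finset_sup'_apply _ fun i _ ↦ (F' i).continuous.neg
  obtain ⟨c, hc, hcle⟩ := (isCompact_sphere (0 : E) 1).exists_forall_le' hcont.continuousOn
    (a := 0) fun v hv ↦ by
      obtain ⟨i, hi⟩ := hneg v (ne_zero_of_mem_unit_sphere ⟨v, hv⟩)
      exact (Finset.lt_sup'_iff _).2 ⟨i, Finset.mem_univ i, neg_pos.2 hi⟩
  have hdescent : ∀ v : E, ∃ i, F' i v ≤ -(c * ‖v‖) := by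
    intro v
    rcases eq_or_ne v 0 with rfl | hv
    · exact ⟨Classical.arbitrary ι, by simp⟩
    have hpos : 0 < ‖v‖ := norm_pos_iff.2 hv
    obtain ⟨i, -, hi⟩ := (Finset.le_sup'_iff _).1
      (hcle (‖v‖⁻¹ • v) (by simp [norm_smul, hpos.ne']))
    refine ⟨i, ?_⟩
    rw [map_smul, smul_eq_mul, ← mul_neg, ← div_eq_inv_mul, le_div_iff₀ hpos] at hi
    linarith
  have hsmall : ∀ᶠ x in nhds x₀, ∀ i,
      ‖F i x - F i x₀ - F' i (x - x₀)‖ ≤ c * ‖x - x₀‖ :=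
    Filter.eventually_all.2 fun i ↦ (hF i).isLittleO.def hc
  filter_upwards [hsmall] with x hx
  obtain ⟨i, hi⟩ := hdescent (x - x₀)
  have := (abs_le.1 (hx i)).2
  exact ⟨i, by linarith⟩

/-- Let `f₁, …, f₅ : ℝ⁴ → ℝ` be convex and differentiable, and let `xs`
be a point where all five agree.  If the gradients `∇f₂ xs, ∇f₃ xs, ∇f₄ xs, ∇f₅ xs` are
linearly independent and `∇f₁ xs` is a linear combination of them with all-negative
coefficients, then `xs` is a local maximum of the pointwise minimum
`g = min {f₁, f₂, f₃, f₄, f₅}`. -/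
theorem stmt_10 (f₁ f₂ f₃ f₄ f₅ : EuclideanSpace ℝ (Fin 4) → ℝ)
    (hc₁ : ConvexOn ℝ Set.univ f₁) (hc₂ : ConvexOn ℝ Set.univ f₂)
    (hc₃ : ConvexOn ℝ Set.univ f₃) (hc₄ : ConvexOn ℝ Set.univ f₄)
    (hc₅ : ConvexOn ℝ Set.univ f₅)
    (hd₁ : Differentiable ℝ f₁) (hd₂ : Differentiable ℝ f₂)
    (hd₃ : Differentiable ℝ f₃) (hd₄ : Differentiable ℝ f₄)
    (hd₅ : Differentiable ℝ f₅)
    (xs : EuclideanSpace ℝ (Fin 4))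
    (he₂ : f₁ xs = f₂ xs) (he₃ : f₁ xs = f₃ xs) (he₄ : f₁ xs = f₄ xs) (he₅ : f₁ xs = f₅ xs)
    (hindep : LinearIndependent ℝ
      ![gradient f₂ xs, gradient f₃ xs, gradient f₄ xs, gradient f₅ xs])
    (a₂ a₃ a₄ a₅ : ℝ) (ha₂ : a₂ < 0) (ha₃ : a₃ < 0) (ha₄ : a₄ < 0) (ha₅ : a₅ < 0)
    (hcomb : gradient f₁ xs =
      a₂ • gradient f₂ xs + a₃ • gradient f₃ xs + a₄ • gradient f₄ xs + a₅ • gradient f₅ xs)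
    (g : EuclideanSpace ℝ (Fin 4) → ℝ)
    (hg : ∀ x, g x = min (f₁ x) (min (f₂ x) (min (f₃ x) (min (f₄ x) (f₅ x))))) :
    IsLocalMax g xs := by
  have hneg : ∀ v : EuclideanSpace ℝ (Fin 4), v ≠ 0 →
      ∃ i, fderiv ℝ (![f₁, f₂, f₃, f₄, f₅] i) xs v < 0 := by
    intro v hv
    by_contra! h
    have hgrad : ∀ f : EuclideanSpace ℝ (Fin 4) → ℝ,
        fderiv ℝ f xs v = inner ℝ (gradient f xs) v := fun f ↦ by simp [gradient]
    have h₁ : 0 ≤ inner ℝ (gradient f₁ xs) v := hgrad f₁ ▸ h 0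
    have h₂ : 0 ≤ inner ℝ (gradient f₂ xs) v := hgrad f₂ ▸ h 1
    have h₃ : 0 ≤ inner ℝ (gradient f₃ xs) v := hgrad f₃ ▸ h 2
    have h₄ : 0 ≤ inner ℝ (gradient f₄ xs) v := hgrad f₄ ▸ h 3
    have h₅ : 0 ≤ inner ℝ (gradient f₅ xs) v := hgrad f₅ ▸ h 4
    simp only [hcomb, inner_add_left, real_inner_smul_left] at h₁
    have k₂ := mul_nonpos_of_nonpos_of_nonneg ha₂.le h₂
    have k₃ := mul_nonpos_of_nonpos_of_nonneg ha₃.le h₃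
    have k₄ := mul_nonpos_of_nonpos_of_nonneg ha₄.le h₄
    have k₅ := mul_nonpos_of_nonpos_of_nonneg ha₅.le h₅
    have z₂ := (mul_eq_zero_iff_left ha₂.ne).1 (by linarith : a₂ * inner ℝ (gradient f₂ xs) v = 0)
    have z₃ := (mul_eq_zero_iff_left ha₃.ne).1 (by linarith : a₃ * inner ℝ (gradient f₃ xs) v = 0)
    have z₄ := (mul_eq_zero_iff_left ha₄.ne).1 (by linarith : a₄ * inner ℝ (gradient f₄ xs) v = 0)
    have z₅ := (mul_eq_zero_iff_left ha₅.ne).1 (by linarith : a₅ * inner ℝ (gradient f₅ xs) v = 0)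
    have hspan := hindep.span_eq_top_of_card_eq_finrank' (by simp)
    have hle : Submodule.span ℝ (Set.range
        ![gradient f₂ xs, gradient f₃ xs, gradient f₄ xs, gradient f₅ xs]) ≤
        (innerSL ℝ v).ker := by
      rw [Submodule.span_le]
      rintro _ ⟨i, rfl⟩
      fin_cases i
      exacts [(real_inner_comm _ _).trans z₂, (real_inner_comm _ _).trans z₃,
        (real_inner_comm _ _).trans z₄, (real_inner_comm _ _).trans z₅]
    rw [hspan] at hle
    have hvv : inner ℝ v v = 0 := by simpa using hle (Submodule.mem_top (x := v))
    exact hv (inner_self_eq_zero.1 hvv)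
  have hdiff : ∀ i, HasFDerivAt (![f₁, f₂, f₃, f₄, f₅] i)
      (fderiv ℝ (![f₁, f₂, f₃, f₄, f₅] i) xs) xs := by
    intro i
    apply DifferentiableAt.hasFDerivAt
    fin_cases i
    exacts [hd₁ xs, hd₂ xs, hd₃ xs, hd₄ xs, hd₅ xs]
  filter_upwards [eventually_exists_le_of_forall_exists_fderiv_neg hdiff hneg] with x hx
  obtain ⟨i, hi⟩ := hx
  rw [hg x, hg xs, ← he₂, ← he₃, ← he₄, ← he₅]
  simp only [min_self, min_le_iff]
  fin_cases i
  · exact .inl hi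
  · exact .inr (.inl (he₂ ▸ hi))
  · exact .inr (.inr (.inl (he₃ ▸ hi)))
  · exact .inr (.inr (.inr (.inl (he₄ ▸ hi))))
  · exact .inr (.inr (.inr (.inr (he₅ ▸ hi))))
end

section
/- Let V ⊆ ℝ^d be a finite nonempty set of points, let c : V → ℝ, and define g(t) := min_{v ∈ V} (c(v) + ‖t − v‖) for t ∈ ℝ^d. If g attains a local maximum at a point t* ∈ ℝ^d, then t* lies in the interior of the convex hull of V. Equivalently, if t* is not in the interior of the convex hull of V, then for every ε > 0 there exists t' ∈ ℝ^d with ‖t' − t*‖ < ε and ‖t' − v‖ > ‖t* − v‖ for every v ∈ V. -/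
/-- A point outside the interior of the convex hull of a nonempty set in a finite-dimensional
inner product space is weakly separated from the set by a nonzero vector. -/
theorem exists_ne_zero_forall_inner_nonneg_of_notMem_interior_convexHull {E : Type*}
    [NormedAddCommGroup E] [InnerProductSpace ℝ E] [FiniteDimensional ℝ E] {S : Set E}
    (hS : S.Nonempty) {x : E} (hx : x ∉ interior (convexHull ℝ S)) :
    ∃ u : E, u ≠ 0 ∧ ∀ v ∈ S, 0 ≤ inner ℝ u (x - v) := by
  rcases (interior (convexHull ℝ S)).eq_empty_or_nonempty with hempty | hne
  · obtain ⟨v₀, hv₀⟩ := hS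
    have hspan : affineSpan ℝ S ≠ ⊤ := by
      rw [Ne, ← interior_convexHull_nonempty_iff_affineSpan_eq_top, hempty]
      simp
    have hdir : (affineSpan ℝ S).direction ≠ ⊤ := by
      rwa [Ne, AffineSubspace.direction_eq_top_iff_of_nonempty
        ⟨v₀, subset_affineSpan ℝ S hv₀⟩]
    rw [Ne, ← Submodule.orthogonal_eq_bot_iff] at hdir
    obtain ⟨u, hu, hu0⟩ := Submodule.exists_mem_ne_zero_of_ne_bot hdir
    have hconst : ∀ v ∈ S, inner ℝ u (x - v) = inner ℝ u (x - v₀) := fun v hv => by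
      have h := Submodule.inner_left_of_mem_orthogonal
        (AffineSubspace.vsub_mem_direction (subset_affineSpan ℝ S hv)
          (subset_affineSpan ℝ S hv₀)) hu
      rw [vsub_eq_sub] at h
      rw [← sub_sub_sub_cancel_right x v v₀, inner_sub_right, h, sub_zero]
    rcases le_total 0 (inner ℝ u (x - v₀)) with h | h
    · exact ⟨u, hu0, fun v hv => (hconst v hv).symm ▸ h⟩
    · refine ⟨-u, neg_ne_zero.2 hu0, fun v hv => ?_⟩
      rw [inner_neg_left, hconst v hv]
      exact neg_nonneg.2 h
  · obtain ⟨f, hf0, hf⟩ := geometric_hahn_banach_of_nonempty_interior_point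
      (convex_convexHull ℝ S) hx hne
    refine ⟨(InnerProductSpace.toDual ℝ E).symm f,
      (LinearIsometryEquiv.map_eq_zero_iff _).not.2 hf0, fun v hv => ?_⟩
    rw [InnerProductSpace.toDual_symm_apply, map_sub]
    exact sub_nonneg.2 (hf v (subset_convexHull ℝ S hv))

/-- Moving in a nonzero direction `u` increases the norm of a vector making a non-obtuse angle
with `u`. -/
theorem norm_lt_norm_add_of_inner_nonneg {E : Type*} [NormedAddCommGroup E]
    [InnerProductSpace ℝ E] {u w : E} (hu : u ≠ 0) (h : 0 ≤ inner ℝ u w) :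
    ‖w‖ < ‖w + u‖ := by
  refine lt_of_pow_lt_pow_left₀ 2 (norm_nonneg _) ?_
  have := norm_add_sq_real w u
  rw [real_inner_comm] at this
  have := pow_pos (norm_pos_iff.2 hu) 2
  linarith

/-- Arbitrarily close to a point outside the interior of the convex hull of `S`, there is a point
farther away from every point of `S`. -/
theorem exists_norm_sub_lt_forall_norm_sub_lt {E : Type*} [NormedAddCommGroup E]
    [InnerProductSpace ℝ E] [FiniteDimensional ℝ E] {S : Set E} (hS : S.Nonempty) {x : E}
    (hx : x ∉ interior (convexHull ℝ S)) {ε : ℝ} (hε : 0 < ε) :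
    ∃ y : E, ‖y - x‖ < ε ∧ ∀ v ∈ S, ‖x - v‖ < ‖y - v‖ := by
  obtain ⟨u, hu, hinner⟩ :=
    exists_ne_zero_forall_inner_nonneg_of_notMem_interior_convexHull hS hx
  have hδ : 0 < ε / 2 / ‖u‖ := div_pos (half_pos hε) (norm_pos_iff.2 hu)
  refine ⟨x + (ε / 2 / ‖u‖) • u, ?_, fun v hv => ?_⟩
  · rw [add_sub_cancel_left, norm_smul, Real.norm_of_nonneg hδ.le,
      div_mul_cancel₀ _ (norm_ne_zero_iff.2 hu)]
    exact half_lt_self hε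
  · rw [add_sub_right_comm]
    refine norm_lt_norm_add_of_inner_nonneg (smul_ne_zero hδ.ne' hu) ?_
    rw [real_inner_smul_left]
    exact mul_nonneg hδ.le (hinner v hv)

/-- Let `V ⊆ ℝ^d` be a finite nonempty set of points, `c : V → ℝ`, and
`g t = min_{v ∈ V} (c v + ‖t - v‖)`.  If `g` attains a local maximum at `ts`, then `ts`
lies in the interior of the convex hull of `V`.  Equivalently, if `ts` is not in the
interior of the convex hull of `V`, then for every `ε > 0` there is `t'` with
`‖t' - ts‖ < ε` and `‖t' - v‖ > ‖ts - v‖` for every `v ∈ V`. -/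
theorem stmt_11 (d : ℕ) (hd : 0 < d)
    (V : Finset (EuclideanSpace ℝ (Fin d))) (hV : V.Nonempty)
    (c : EuclideanSpace ℝ (Fin d) → ℝ)
    (g : EuclideanSpace ℝ (Fin d) → ℝ)
    (hg : ∀ t, g t = V.inf' hV (fun v => c v + ‖t - v‖))
    (ts : EuclideanSpace ℝ (Fin d)) :
    (IsLocalMax g ts →
      ts ∈ interior (convexHull ℝ (V : Set (EuclideanSpace ℝ (Fin d))))) ∧
    (ts ∉ interior (convexHull ℝ (V : Set (EuclideanSpace ℝ (Fin d)))) →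
      ∀ ε > 0, ∃ t' : EuclideanSpace ℝ (Fin d),
        ‖t' - ts‖ < ε ∧ ∀ v ∈ V, ‖ts - v‖ < ‖t' - v‖) := by
  have hfar := fun h ε (hε : 0 < ε) =>
    exists_norm_sub_lt_forall_norm_sub_lt (S := (V : Set (EuclideanSpace ℝ (Fin d))))
      hV.to_set (x := ts) h hε
  refine ⟨fun hmax => ?_, hfar⟩
  by_contra hts
  obtain ⟨ε, hε, hball⟩ := Metric.eventually_nhds_iff.1 hmax
  obtain ⟨t', ht', hlt⟩ := hfar hts ε hε
  refine (hball (dist_eq_norm t' ts ▸ ht')).not_gt ?_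
  rw [hg, hg, Finset.lt_inf'_iff]
  exact fun v hv => (Finset.inf'_le _ hv).trans_lt (by gcongr; exact hlt v hv)
end
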